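/- For every natural number N, there exist a connected finite simple graph G and an edge e = uv ∈ E(G) such that the graph G − e obtained by deleting e is connected and bdim(G − e) ≥ bdim(G) + d_{G−e}(u,v) + N. That is, bdim(G − e) − bdim(G) can be arbitrarily larger than d_{G−e}(u,v). -/

import Mathlib

open SimpleGraph

/-- `f` is a resolving broadcast of `G`: for any two distinct vertices `x, y` there is a
vertex `z` with `f z > 0` such that `min (d(x,z)) (f z + 1) ≠ min (d(y,z)) (f z + 1)`,
where distances are extended naturals (`⊤` for vertices in different components). -/
def IsResolvingBroadcast {V : Type*} (G : SimpleGraph V) (f : V → ℕ) : Prop :=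
  ∀ x y : V, x ≠ y → ∃ z : V, 0 < f z ∧
    min (G.edist x z) ((f z : ℕ∞) + 1) ≠ min (G.edist y z) ((f z : ℕ∞) + 1)

/-- The broadcast dimension of `G`: the minimum of `∑ v, f v` over all
resolving broadcasts `f` of `G`. -/
noncomputable def bdim {V : Type*} [Fintype V] (G : SimpleGraph V) : ℕ :=
  sInf {n : ℕ | ∃ f : V → ℕ, IsResolvingBroadcast G f ∧ ∑ v, f v = n}

namespace SimpleGraph

variable {V : Type*} {G : SimpleGraph V}

lemma natCast_le_add_edist (φ : V → ℕ) (h : ∀ u v, G.Adj u v → φ u ≤ φ v + 1) (u v : V) :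
    (φ u : ℕ∞) ≤ φ v + G.edist u v := by
  by_cases htop : G.edist u v = ⊤
  · simp [htop]
  obtain ⟨w, hw⟩ := exists_walk_of_edist_ne_top htop
  rw [← hw]
  clear hw htop
  norm_cast
  induction w with
  | nil => simp
  | cons hadj p ih =>
    have := h _ _ hadj
    rw [Walk.length_cons]
    omega

lemma edist_le_of_descent (ψ : V → ℕ) (z : V)
    (h : ∀ v, v ≠ z → ∃ w, G.Adj v w ∧ ψ w < ψ v) (v : V) : G.edist v z ≤ ψ v := by
  induction hn : ψ v using Nat.strong_induction_on generalizing v with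
  | _ n ih =>
    by_cases hv : v = z
    · simp [hv]
    obtain ⟨w, hadj, hlt⟩ := h v hv
    calc G.edist v z ≤ G.edist v w + G.edist w z := G.edist_triangle
      _ ≤ 1 + (ψ w : ℕ∞) :=
        add_le_add (edist_eq_one_iff_adj.mpr hadj).le (ih _ (hn ▸ hlt) w rfl)
      _ ≤ n := by norm_cast; omega

lemma connected_of_descent (ψ : V → ℕ) (z : V)
    (h : ∀ v, v ≠ z → ∃ w, G.Adj v w ∧ ψ w < ψ v) : G.Connected := by
  have hz (v : V) : G.Reachable v z := edist_ne_top_iff_reachable.mp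
    (ne_top_of_le_ne_top (ENat.natCast_ne_top _) (edist_le_of_descent ψ z h v))
  exact (connected_iff G).mpr ⟨fun u v => (hz u).trans (hz v).symm, ⟨z⟩⟩

lemma edist_map_le {W : Type*} {H : SimpleGraph W} (φ : G →g H) (u v : V) :
    H.edist (φ u) (φ v) ≤ G.edist u v := by
  by_cases htop : G.edist u v = ⊤
  · simp [htop]
  obtain ⟨w, hw⟩ := exists_walk_of_edist_ne_top htop
  rw [← hw, ← Walk.length_map φ w]
  exact edist_le _

lemma edist_map_eq_of_involutive (φ : G →g G) (hφ : Function.Involutive φ) (u v : V) :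
    G.edist (φ u) (φ v) = G.edist u v :=
  le_antisymm (edist_map_le φ u v) (by simpa only [hφ u, hφ v] using edist_map_le φ (φ u) (φ v))

end SimpleGraph

section Broadcast

variable {V : Type*} {G : SimpleGraph V}

lemma truncated_edist_ne_of_adj {x y z : V} {m : ℕ} (hm : 0 < m) (hx : x = z ∨ G.Adj x z)
    (hy : ¬ G.Adj y z) (hyz : y ≠ z) :
    min (G.edist x z) ((m : ℕ∞) + 1) ≠ min (G.edist y z) ((m : ℕ∞) + 1) := by
  have h1 : G.edist x z ≤ 1 := edist_le_one_iff_adj_or_eq.mpr hx.symm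
  have h2 : 1 < G.edist y z := by
    rw [← not_le, edist_le_one_iff_adj_or_eq]
    tauto
  have h3 : (1 : ℕ∞) < (m : ℕ∞) + 1 := by norm_cast; omega
  exact ((min_le_left _ _).trans h1 |>.trans_lt (lt_min h2 h3)).ne

lemma truncated_edist_ne_of_self {x y : V} (m : ℕ) (hxy : x ≠ y) :
    min (G.edist x x) ((m : ℕ∞) + 1) ≠ min (G.edist y x) ((m : ℕ∞) + 1) := by
  rw [edist_self, zero_min]
  exact (lt_min (edist_pos_of_ne hxy.symm) (by positivity)).ne

lemma isResolvingBroadcast_one (G : SimpleGraph V) : IsResolvingBroadcast G fun _ => 1 :=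
  fun x _ hxy => ⟨x, one_pos, truncated_edist_ne_of_self 1 hxy⟩

lemma bdim_le [Fintype V] {f : V → ℕ} (hf : IsResolvingBroadcast G f) : bdim G ≤ ∑ v, f v :=
  Nat.sInf_le ⟨f, hf, rfl⟩

lemma le_bdim [Fintype V] {n : ℕ} (h : ∀ f, IsResolvingBroadcast G f → n ≤ ∑ v, f v) :
    n ≤ bdim G := by
  refine le_csInf ⟨_, _, isResolvingBroadcast_one G, rfl⟩ ?_
  rintro _ ⟨f, hf, rfl⟩
  exact h f hf

end Broadcast

/-- The vertices of a spider with `k` legs of length `n + 1`; `none` is its centre. -/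
abbrev Spider (k n : ℕ) : Type := Option (Fin k × Fin (n + 1))

namespace Spider

variable {k n : ℕ}

/-- The distance from the centre. -/
def depth (q : Spider k n) : ℕ := q.elim 0 fun p => p.2 + 1

/-- The leg containing a vertex other than the centre. -/
def leg (q : Spider k n) : Option (Fin k) := q.map Prod.fst

/-- `IsChild p q` means that `q` follows `p` on a leg. -/
def IsChild (p q : Spider k n) : Prop :=
  depth q = depth p + 1 ∧ (leg p = none ∨ leg p = leg q)

/-- The end of a leg. -/
def foot (i : Fin k) : Spider k n := some (i, Fin.last n)

lemma eq_none_of_leg_eq_none {q : Spider k n} (h : leg q = none) : q = none := by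
  simpa [leg] using h

lemma depth_le (q : Spider k n) : depth q ≤ n + 1 := by
  rcases q with _ | ⟨i, t⟩ <;> simp [depth]
  omega

lemma exists_isChild {q : Spider k n} (h : q ≠ none) : ∃ p, IsChild p q := by
  rcases q with _ | ⟨i, t, ht⟩
  · exact absurd rfl h
  rcases t with _ | t
  · exact ⟨none, by simp [IsChild, depth, leg]⟩
  · exact ⟨some (i, ⟨t, by omega⟩), by simp [IsChild, depth, leg]⟩

end Spider

open Spider

/-- Every vertex of the spider is replaced by three twins indexed by `Fin 3`,
all joined to two disjoint edges. -/
abbrev SpiderVertex (k n : ℕ) : Type := Spider k n × (Fin 3 ⊕ Bool × Bool)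

/-- Three copies of the spider, where the three copies of each vertex are joined to a common
gadget consisting of two disjoint edges. -/
def tripleSpider (k n : ℕ) : SimpleGraph (SpiderVertex k n) where
  Adj
    | (p, .inl a), (q, .inl b) => a = b ∧ (IsChild p q ∨ IsChild q p)
    | (p, .inl _), (q, .inr _) => p = q
    | (p, .inr _), (q, .inl _) => p = q
    | (p, .inr (b, c)), (q, .inr (b', c')) => p = q ∧ b = b' ∧ c ≠ c'
  symm := ⟨by
    rintro ⟨p, a | ⟨b, c⟩⟩ ⟨q, a' | ⟨b', c'⟩⟩ h
    · exact ⟨h.1.symm, h.2.symm⟩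
    · exact h.symm
    · exact h.symm
    · exact ⟨h.1.symm, h.2.1.symm, h.2.2.symm⟩⟩
  loopless := ⟨by
    rintro ⟨p, a | ⟨b, c⟩⟩ h
    · simp [IsChild] at h
    · exact h.2.2 rfl⟩

section TripleSpider

variable {k n : ℕ}

@[simp] lemma tripleSpider_adj_inl_inl {p q : Spider k n} {a b : Fin 3} :
    (tripleSpider k n).Adj (p, .inl a) (q, .inl b) ↔ a = b ∧ (IsChild p q ∨ IsChild q p) :=
  Iff.rfl

@[simp] lemma tripleSpider_adj_inl_inr {p q : Spider k n} {a : Fin 3} {s : Bool × Bool} :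
    (tripleSpider k n).Adj (p, .inl a) (q, .inr s) ↔ p = q :=
  Iff.rfl

@[simp] lemma tripleSpider_adj_inr_inl {p q : Spider k n} {a : Fin 3} {s : Bool × Bool} :
    (tripleSpider k n).Adj (p, .inr s) (q, .inl a) ↔ p = q :=
  Iff.rfl

@[simp] lemma tripleSpider_adj_inr_inr {p q : Spider k n} {s s' : Bool × Bool} :
    (tripleSpider k n).Adj (p, .inr s) (q, .inr s') ↔ p = q ∧ s.1 = s'.1 ∧ s.2 ≠ s'.2 :=
  Iff.rfl

lemma tripleSpider_connected : (tripleSpider k n).Connected := by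
  refine connected_of_descent
    (fun v => v.2.elim (fun a => if v.1 = none ∧ a = 0 then 0 else depth v.1 + 2)
      fun _ => if v.1 = none then 1 else depth v.1 + 3) (none, .inl 0) ?_
  rintro ⟨q, a | s⟩ hv
  · by_cases hq : q = none
    · subst hq
      have ha : a ≠ 0 := by rintro rfl; exact hv rfl
      exact ⟨(none, .inr (true, true)), by simp, by simp [ha, depth]⟩
    · obtain ⟨p, hp⟩ := exists_isChild hq
      refine ⟨(p, .inl a), by simp [hp], ?_⟩
      have := hp.1
      simp only [Sum.elim_inl, hq, false_and, if_false]
      split_ifs <;> omega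
  · refine ⟨(q, .inl 0), by simp, ?_⟩
    by_cases hq : q = none <;> simp [hq]

/-- The endomorphism permuting the three copies of the spider and exchanging the ends of the
gadget edges selected by `ε`. -/
def tripleSpiderHom (σ : Equiv.Perm (Fin 3)) (ε : Spider k n → Bool → Bool) :
    tripleSpider k n →g tripleSpider k n where
  toFun v := (v.1, v.2.map σ fun s => (s.1, xor s.2 (ε v.1 s.1)))
  map_rel' := by
    rintro ⟨p, a | ⟨b, c⟩⟩ ⟨q, a' | ⟨b', c'⟩⟩ h
    · exact ⟨congrArg σ h.1, h.2⟩
    · exact h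
    · exact h
    · obtain ⟨rfl, hb, hc⟩ := h
      obtain rfl : b = b' := hb
      exact ⟨rfl, rfl, by simpa using hc⟩

lemma tripleSpiderHom_involutive {σ : Equiv.Perm (Fin 3)} (hσ : Function.Involutive σ)
    (ε : Spider k n → Bool → Bool) : Function.Involutive (tripleSpiderHom σ ε) := by
  rintro ⟨p, a | ⟨b, c⟩⟩
  · simp [tripleSpiderHom, hσ a]
  · simp [tripleSpiderHom]

lemma twin_pos_of_isResolvingBroadcast {f : SpiderVertex k n → ℕ}
    (hf : IsResolvingBroadcast (tripleSpider k n) f) (q : Spider k n) (b : Bool) :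
    1 ≤ f (q, .inr (b, true)) + f (q, .inr (b, false)) := by
  classical
  obtain ⟨z, hz, hne⟩ := hf (q, .inr (b, true)) (q, .inr (b, false)) (by simp)
  by_contra! h0
  have hz1 : z ≠ (q, .inr (b, true)) := by rintro rfl; omega
  have hz2 : z ≠ (q, .inr (b, false)) := by rintro rfl; omega
  have hinv := edist_map_eq_of_involutive _ (tripleSpiderHom_involutive (k := k) (n := n)
    (σ := 1) (fun _ => rfl) (fun p b' => decide (p = q ∧ b' = b))) (q, .inr (b, true)) z
  have hfix : tripleSpiderHom (k := k) (n := n) 1 (fun p b' => decide (p = q ∧ b' = b)) z = z := by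
    rcases z with ⟨p, a | ⟨b', c⟩⟩
    · simp [tripleSpiderHom]
    · have : ¬ (p = q ∧ b' = b) := by
        rintro ⟨rfl, rfl⟩
        cases c <;> simp_all
      simp [tripleSpiderHom, decide_eq_false this, -Bool.decide_and]
  rw [hfix] at hinv
  simp only [tripleSpiderHom, RelHom.coeFn_mk, Sum.map_inr, decide_true, and_self, Bool.xor_true,
    Bool.not_true] at hinv
  exact hne (by rw [hinv])

lemma le_edist_foot {q : Spider k n} {i : Fin k} (h : leg q ≠ some i) (a : Fin 3)
    (s : Fin 3 ⊕ Bool × Bool) :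
    ((n + 1 : ℕ) : ℕ∞) ≤ (tripleSpider k n).edist (foot i, .inl a) (q, s) := by
  have := natCast_le_add_edist (G := tripleSpider k n)
    (fun v => if leg v.1 = some i then depth v.1 else 0) ?_ (foot i, .inl a) (q, s)
  · rw [if_neg h] at this
    simpa [foot, leg, depth] using this
  · rintro ⟨p, a | s⟩ ⟨q, a' | s'⟩ hadj
    · rcases hadj.2 with ⟨h1, h2⟩ | ⟨h1, h2⟩ <;> rcases h2 with h2 | h2
      · simp [h2]
      · dsimp only; rw [h2]; split_ifs <;> omega
      · have := eq_none_of_leg_eq_none h2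
        subst this
        simp only [depth, Option.elim] at h1 ⊢
        split_ifs <;> omega
      · dsimp only; rw [h2]; split_ifs <;> omega
    · obtain rfl : p = q := hadj
      simp
    · obtain rfl : p = q := hadj
      simp
    · obtain rfl : p = q := hadj.1
      simp

lemma exists_source_of_foot {f : SpiderVertex k n → ℕ}
    (hf : IsResolvingBroadcast (tripleSpider k n) f) (i : Fin k) {a b : Fin 3} (hab : a ≠ b) :
    ∃ q c, (c = a ∨ c = b) ∧ 0 < f (q, .inl c) ∧
      (leg q = some i ∨ n + 1 ≤ f (q, .inl c)) := by
  obtain ⟨⟨q, s⟩, hz, hne⟩ := hf (foot i, .inl a) (foot i, .inl b) (by simpa using hab)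
  have hinv := edist_map_eq_of_involutive _ (tripleSpiderHom_involutive (k := k) (n := n)
    (Equiv.swap_apply_self a b : Function.Involutive (Equiv.swap a b)) fun _ _ => false)
    (foot i, .inl a) (q, s)
  have hs : tripleSpiderHom (Equiv.swap a b) (fun _ _ => false) (q, s) ≠ (q, s) := by
    intro hfix
    rw [hfix] at hinv
    simp only [tripleSpiderHom, RelHom.coeFn_mk, Sum.map_inl, Equiv.swap_apply_left] at hinv
    exact hne (by rw [hinv])
  rcases s with c | s
  · refine ⟨q, c, ?_, hz, ?_⟩
    · by_contra! hc
      exact hs (by simp [tripleSpiderHom, Equiv.swap_apply_of_ne_of_ne hc.1 hc.2])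
    · by_contra! hfar
      have hlt : (f (q, .inl c) : ℕ∞) + 1 ≤ ((n + 1 : ℕ) : ℕ∞) := by exact_mod_cast hfar.2
      apply hne
      rw [min_eq_right (hlt.trans (le_edist_foot hfar.1 _ _)),
        min_eq_right (hlt.trans (le_edist_foot hfar.1 _ _))]
  · exact absurd (by simp [tripleSpiderHom]) hs

lemma le_sum_core {f : SpiderVertex k n → ℕ}
    (hf : IsResolvingBroadcast (tripleSpider k n) f) (hk : 2 * (n + 1) ≤ k) :
    2 * (n + 1) ≤ ∑ v : Spider k n × Fin 3, f (v.1, .inl v.2) := by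
  classical
  by_cases hbig : ∃ v w : Spider k n × Fin 3, v ≠ w ∧
      n + 1 ≤ f (v.1, .inl v.2) ∧ n + 1 ≤ f (w.1, .inl w.2)
  · obtain ⟨v, w, hvw, hv, hw⟩ := hbig
    calc 2 * (n + 1) ≤ ∑ u ∈ {v, w}, f (u.1, .inl u.2) := by
          rw [Finset.sum_pair hvw]; omega
      _ ≤ _ := Finset.sum_le_sum_of_subset (Finset.subset_univ _)
  · have hsrc (i : Fin k) : ∃ v : Spider k n × Fin 3, 0 < f (v.1, .inl v.2) ∧ leg v.1 = some i := by
      obtain ⟨q, c, -, hpos, hq⟩ := exists_source_of_foot hf i (a := 0) (b := 1) (by decide)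
      obtain ⟨a, b, hab, hca, hcb⟩ : ∃ a b : Fin 3, a ≠ b ∧ c ≠ a ∧ c ≠ b := by
        clear * -
        revert c
        decide
      obtain ⟨q', c', hc', hpos', hq'⟩ := exists_source_of_foot hf i hab
      have hcc : c ≠ c' := by rcases hc' with rfl | rfl <;> assumption
      rcases hq with hq | hq
      · exact ⟨(q, c), hpos, hq⟩
      rcases hq' with hq' | hq'
      · exact ⟨(q', c'), hpos', hq'⟩
      exact absurd ⟨(q, c), (q', c'), fun h => hcc (congrArg Prod.snd h), hq, hq'⟩ hbig
    choose w hw hleg using hsrc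
    have hinj : Function.Injective w := fun i j hij => by
      have := (hleg i).symm.trans ((congrArg (fun v => leg v.1) hij).trans (hleg j))
      exact Option.some_injective _ this
    calc 2 * (n + 1) ≤ ∑ _i : Fin k, 1 := by simpa using hk
      _ ≤ ∑ i, f ((w i).1, .inl (w i).2) := Finset.sum_le_sum fun i _ => hw i
      _ = ∑ v ∈ Finset.univ.image w, f (v.1, .inl v.2) :=
        (Finset.sum_image (f := fun v : Spider k n × Fin 3 => f (v.1, .inl v.2))
          fun i _ j _ h => hinj h).symm
      _ ≤ _ := Finset.sum_le_sum_of_subset (Finset.subset_univ _)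

lemma sum_spiderVertex (f : SpiderVertex k n → ℕ) :
    ∑ v, f v = ∑ v : Spider k n × Fin 3, f (v.1, .inl v.2) +
      ∑ v : Spider k n × Bool, (f (v.1, .inr (v.2, true)) + f (v.1, .inr (v.2, false))) := by
  rw [Fintype.sum_prod_type, Fintype.sum_prod_type, Fintype.sum_prod_type,
    ← Finset.sum_add_distrib]
  refine Finset.sum_congr rfl fun q _ => ?_
  rw [Fintype.sum_sum_type, Fintype.sum_prod_type]
  simp only [Fintype.sum_bool]

lemma le_bdim_tripleSpider (hk : 2 * (n + 1) ≤ k) :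
    2 * (n + 1) + Fintype.card (Spider k n × Bool) ≤ bdim (tripleSpider k n) := by
  refine le_bdim fun f hf => ?_
  rw [sum_spiderVertex, Fintype.card_eq_sum_ones]
  exact add_le_add (le_sum_core hf hk)
    (Finset.sum_le_sum fun v _ => twin_pos_of_isResolvingBroadcast hf v.1 v.2)

/-- The triple spider with an additional edge between two copies of its centre. -/
def linkedSpider (k n : ℕ) : SimpleGraph (SpiderVertex k n) :=
  tripleSpider k n ⊔ edge (none, .inl 0) (none, .inl 1)

lemma linkedSpider_deleteEdges :
    (linkedSpider k n).deleteEdges {s((none, .inl 0), (none, .inl 1))} = tripleSpider k n := by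
  have h : ¬ (tripleSpider k n).Adj (none, .inl 0) (none, .inl 1) := by simp
  ext u v
  simp only [linkedSpider, deleteEdges_adj, sup_adj, edge_adj, Set.mem_singleton_iff, Sym2.eq_iff]
  constructor
  · tauto
  · intro huv
    refine ⟨Or.inl huv, ?_⟩
    rintro (⟨rfl, rfl⟩ | ⟨rfl, rfl⟩)
    · exact h huv
    · exact h huv.symm

/-- The distance to the copy `0` of the centre in the linked spider. -/
def linkedRank (v : SpiderVertex k n) : ℕ := depth v.1 + v.2.elim (fun a => a.val) fun _ => 1

lemma linkedRank_le_of_adj {u v : SpiderVertex k n} (h : (linkedSpider k n).Adj u v) :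
    linkedRank u ≤ linkedRank v + 1 := by
  rw [linkedSpider, sup_adj, edge_adj] at h
  rcases h with h | ⟨⟨rfl, rfl⟩ | ⟨rfl, rfl⟩, -⟩
  · rcases u with ⟨p, a | s⟩ <;> rcases v with ⟨q, a' | s'⟩
    · obtain ⟨rfl, h | h⟩ := h <;> have := h.1 <;> simp only [linkedRank, Sum.elim_inl] <;> omega
    · obtain rfl : p = q := h
      simp only [linkedRank, Sum.elim_inl, Sum.elim_inr]
      omega
    · obtain rfl : p = q := h
      simp only [linkedRank, Sum.elim_inl, Sum.elim_inr]
      omega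
    · obtain rfl : p = q := h.1
      simp [linkedRank]
  · simp [linkedRank, depth]
  · simp [linkedRank]

lemma linkedSpider_edist (v : SpiderVertex k n) :
    (linkedSpider k n).edist v (none, .inl 0) = linkedRank v := by
  refine le_antisymm (edist_le_of_descent _ _ ?_ v) ?_
  · rintro ⟨q, a | s⟩ hv
    · by_cases hq : q = none
      · subst hq
        fin_cases a
        · exact absurd rfl hv
        · exact ⟨(none, .inl 0), by simp [linkedSpider, edge_adj], by simp [linkedRank]⟩
        · exact ⟨(none, .inr (true, true)), by simp [linkedSpider], by simp [linkedRank]⟩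
      · obtain ⟨p, hp⟩ := exists_isChild hq
        exact ⟨(p, .inl a), by simp [linkedSpider, hp], by simp [linkedRank, hp.1]⟩
    · exact ⟨(q, .inl 0), by simp [linkedSpider], by simp [linkedRank]⟩
  · simpa [linkedRank, depth] using
      natCast_le_add_edist linkedRank (fun _ _ => linkedRank_le_of_adj) v (none, .inl 0)

@[simp] lemma linkedSpider_adj_inr {v : SpiderVertex k n} {q : Spider k n} {s : Bool × Bool} :
    (linkedSpider k n).Adj v (q, .inr s) ↔ (tripleSpider k n).Adj v (q, .inr s) := by
  simp [linkedSpider, edge_adj]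

/-- One end of every gadget edge broadcasts with strength `1`, and the copy `0` of the centre
reaches every vertex. -/
def linkedBroadcast (v : SpiderVertex k n) : ℕ :=
  v.2.elim (fun a => if v.1 = none ∧ a = 0 then n + 2 else 0) fun s => if s.2 then 1 else 0

lemma linkedBroadcast_resolves : IsResolvingBroadcast (linkedSpider k n) linkedBroadcast := by
  have key (q : Spider k n) (b : Bool) {x y : SpiderVertex k n}
      (hx : x = (q, .inr (b, true)) ∨ (linkedSpider k n).Adj x (q, .inr (b, true)))
      (hy : ¬ (linkedSpider k n).Adj y (q, .inr (b, true))) (hyz : y ≠ (q, .inr (b, true))) :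
      ∃ z, 0 < linkedBroadcast z ∧
        min ((linkedSpider k n).edist x z) ((linkedBroadcast z : ℕ∞) + 1) ≠
          min ((linkedSpider k n).edist y z) ((linkedBroadcast z : ℕ∞) + 1) :=
    ⟨(q, .inr (b, true)), by simp [linkedBroadcast],
      truncated_edist_ne_of_adj (by simp [linkedBroadcast]) hx hy hyz⟩
  have hself (q : Spider k n) (b : Bool) {y : SpiderVertex k n} (hy : (q, .inr (b, true)) ≠ y) :
      ∃ z, 0 < linkedBroadcast z ∧
        min ((linkedSpider k n).edist (q, .inr (b, true)) z) ((linkedBroadcast z : ℕ∞) + 1) ≠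
          min ((linkedSpider k n).edist y z) ((linkedBroadcast z : ℕ∞) + 1) :=
    ⟨(q, .inr (b, true)), by simp [linkedBroadcast], truncated_edist_ne_of_self _ hy⟩
  have hmix (p : Spider k n) (a : Fin 3) (q : Spider k n) (b : Bool) :
      ∃ z, 0 < linkedBroadcast z ∧
        min ((linkedSpider k n).edist (p, .inl a) z) ((linkedBroadcast z : ℕ∞) + 1) ≠
          min ((linkedSpider k n).edist (q, .inr (b, false)) z)
            ((linkedBroadcast z : ℕ∞) + 1) :=
    key p (!b) (by simp) (by simp) (by simp)
  rintro ⟨p, a | ⟨b, _ | _⟩⟩ ⟨q, a' | ⟨b', _ | _⟩⟩ hxy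
  · by_cases hpq : p = q
    · subst hpq
      have haa : (a : ℕ) ≠ a' := fun h => hxy (by rw [Fin.ext h])
      have hd := depth_le p
      refine ⟨(none, .inl 0), by simp [linkedBroadcast], ?_⟩
      rw [linkedSpider_edist, linkedSpider_edist]
      simp only [linkedRank, linkedBroadcast, Sum.elim_inl, and_self, if_true]
      norm_cast
      rw [← Nat.mono_cast.map_min, ← Nat.mono_cast.map_min, Nat.cast_inj]
      omega
    · exact key p true (by simp) (by simpa using Ne.symm hpq) (by simp)
  · exact hmix p a q b'
  · obtain ⟨z, hz, h⟩ := hself q b' hxy.symm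
    exact ⟨z, hz, h.symm⟩
  · obtain ⟨z, hz, h⟩ := hmix q a' p b
    exact ⟨z, hz, h.symm⟩
  · refine key p b (by simp) ?_ (by simp)
    simp only [linkedSpider_adj_inr, tripleSpider_adj_inr_inr]
    rintro ⟨rfl, rfl, -⟩
    exact hxy rfl
  · obtain ⟨z, hz, h⟩ := hself q b' hxy.symm
    exact ⟨z, hz, h.symm⟩
  all_goals exact hself p b hxy

lemma bdim_linkedSpider_le :
    bdim (linkedSpider k n) ≤ n + 2 + Fintype.card (Spider k n × Bool) := by
  refine (bdim_le linkedBroadcast_resolves).trans_eq ?_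
  rw [sum_spiderVertex]
  congr 1
  · rw [Fintype.sum_eq_single (none, 0)]
    · simp [linkedBroadcast]
    · rintro ⟨q, a⟩ h
      have : ¬ (q = none ∧ a = 0) := by rintro ⟨rfl, rfl⟩; exact h rfl
      simp [linkedBroadcast, this]
  · simp [linkedBroadcast]

end TripleSpider

/-- `bdim (G - e) - bdim G` can be arbitrarily larger than `d_{G-e}(u, v)`: for every
`N` there are a connected graph `G` and an edge `e = uv` with `G - e` connected and
`bdim (G - e) ≥ bdim G + d_{G-e}(u, v) + N`. -/
theorem bdim_deleteEdge_sub_bdim_unbounded (N : ℕ) :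
    ∃ (V : Type) (inst : Fintype V) (G : SimpleGraph V) (u v : V),
      G.Adj u v ∧ G.Connected ∧ (G.deleteEdges {s(u, v)}).Connected ∧
      @bdim V inst G + (G.deleteEdges {s(u, v)}).dist u v + N ≤
        @bdim V inst (G.deleteEdges {s(u, v)}) := by
  have hdel := linkedSpider_deleteEdges (k := 2 * (N + 3)) (n := N + 2)
  refine ⟨SpiderVertex (2 * (N + 3)) (N + 2), inferInstance, linkedSpider _ _,
    (none, .inl 0), (none, .inl 1), ?_, ?_, ?_, ?_⟩
  · simp [linkedSpider, edge_adj]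
  · exact tripleSpider_connected.mono le_sup_left
  · rw [hdel]
    exact tripleSpider_connected
  · rw [hdel]
    have hlow := le_bdim_tripleSpider (k := 2 * (N + 3)) (n := N + 2) le_rfl
    have hup := bdim_linkedSpider_le (k := 2 * (N + 3)) (n := N + 2)
    have h0 : (tripleSpider (2 * (N + 3)) (N + 2)).Adj (none, .inl 0)
        (none, .inr (true, true)) := by simp
    have h1 : (tripleSpider (2 * (N + 3)) (N + 2)).Adj (none, .inr (true, true))
        (none, .inl 1) := by simp
    have hdist := dist_le (Walk.cons h0 (Walk.cons h1 Walk.nil))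
    simp only [Walk.length_cons, Walk.length_nil] at hdist
    omega
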